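/- Let N ∈ ℕ, 1 ≤ n ≤ N, and α, β ∈ (−1, +∞), and let Q_n(x;α,β,N) be the Hahn polynomial of degree n. Then Q_n(·;α,β,N) has n simple real roots x_{1,n}(α,β) < ... < x_{n,n}(α,β) in (0,N) with consecutive gaps greater than 1. Moreover these roots are strictly increasing in α and strictly decreasing in β: if −1 < α_1 < α_2 then x_{j,n}(α_1,β) < x_{j,n}(α_2,β) for every j, and if −1 < β_1 < β_2 then x_{j,n}(α,β_1) > x_{j,n}(α,β_2) for every j. -/

import Mathlib

open Polynomial Filter

noncomputable def deltaOp (h : ℝ) (f : ℝ → ℝ) (x : ℝ) : ℝ := f (x + h) - f x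

noncomputable def nablaOp (h : ℝ) (f : ℝ → ℝ) (x : ℝ) : ℝ := f x - f (x - h)

noncomputable def forceF (h x y : ℝ) : ℝ := 1 / (2 * h) * Real.log ((y - x + h) / (y - x - h))

noncomputable def potV (h x y : ℝ) : ℝ :=
  (x - y) / (2 * h) * Real.log ((y - x + h) / (y - x - h))
    - 1 / 2 * Real.log ((y - x + h) * (y - x - h))

noncomputable def extForce (h : ℝ) (A B : Polynomial ℝ) (x : ℝ) : ℝ :=
  1 / (2 * h) * Real.log (1 + B.eval x / A.eval x)

noncomputable def energy (h : ℝ) (φ : ℝ → ℝ) {n : ℕ} (x : Fin n → ℝ) : ℝ :=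
  (∑ j, ∑ k ∈ Finset.univ.erase j, potV h (x k) (x j)) + 2 * ∑ j, φ (x j)

def GapGt (h : ℝ) {n : ℕ} (x : Fin n → ℝ) : Prop :=
  ∀ i : ℕ, ∀ hi : i + 1 < n, x ⟨i + 1, hi⟩ - x ⟨i, Nat.lt_of_succ_lt hi⟩ > h

def SatisfiesDiffEq (h : ℝ) (A B C p : Polynomial ℝ) : Prop :=
  ∀ x : ℝ,
    A.eval x * deltaOp h (nablaOp h fun t => p.eval t) x
      + B.eval x * deltaOp h (fun t => p.eval t) x + C.eval x * p.eval x = 0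

def InIoo (a b : EReal) (y : ℝ) : Prop := a < (y : EReal) ∧ (y : EReal) < b

def IsCriticalDist (h : ℝ) (A B : Polynomial ℝ) (a b : EReal) {n : ℕ}
    (x : Fin n → ℝ) : Prop :=
  StrictMono x ∧ (∀ j, InIoo a b (x j)) ∧ GapGt h x ∧
    ∀ j, (∑ k ∈ Finset.univ.erase j, forceF h (x k) (x j)) + extForce h A B (x j) = 0

def Admissible (h : ℝ) (a b : EReal) {n : ℕ} (x : Fin n → ℝ) : Prop :=
  StrictMono x ∧ (∀ j, a ≤ (x j : EReal) ∧ (x j : EReal) ≤ b) ∧ GapGt h x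

def IsEquilibrium (h : ℝ) (φ : ℝ → ℝ) (a b : EReal) {n : ℕ} (x : Fin n → ℝ) : Prop :=
  Admissible h a b x ∧ ∀ y : Fin n → ℝ, Admissible h a b y → energy h φ x ≤ energy h φ y

noncomputable def ratFn (A B : Polynomial ℝ) (x : ℝ) : ℝ := 1 + B.eval x / A.eval x

def GConvexOn (A B : Polynomial ℝ) (a b : EReal) : Prop :=
  a < b ∧
  (∀ x : ℝ, InIoo a b x → 0 < ratFn A B x) ∧
  (∀ x y : ℝ, InIoo a b x → InIoo a b y → x < y → ratFn A B y < ratFn A B x) ∧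
  (∀ a' : ℝ, a = (a' : EReal) → A.eval a' = 0) ∧
  (a = ⊥ → (Tendsto (ratFn A B) atBot atTop ∨
      ∃ L : ℝ, 1 < L ∧ Tendsto (ratFn A B) atBot (nhds L))) ∧
  (∀ b' : ℝ, b = (b' : EReal) → (A + B).eval b' = 0) ∧
  (b = ⊤ → ∃ L : ℝ, 0 ≤ L ∧ L < 1 ∧ Tendsto (ratFn A B) atTop (nhds L))

def IsPotential (h : ℝ) (A B : Polynomial ℝ) (a b : EReal) (φ : ℝ → ℝ) : Prop :=
  ∀ x : ℝ, InIoo a b x → HasDerivAt φ (-(extForce h A B x)) x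

noncomputable def partialD {n : ℕ} (f : (Fin n → ℝ) → ℝ) (j : Fin n) (z : Fin n → ℝ) : ℝ :=
  deriv (fun t => f (Function.update z j t)) (z j)

noncomputable def poch (t : ℝ) (k : ℕ) : ℝ := (ascPochhammer ℝ k).eval t

noncomputable def negXPoch (k : ℕ) : Polynomial ℝ := (ascPochhammer ℝ k).comp (-Polynomial.X)

noncomputable def charlier (n : ℕ) (a : ℝ) : Polynomial ℝ :=
  ∑ k ∈ Finset.range (n + 1),
    Polynomial.C (poch (-(n : ℝ)) k / (k.factorial : ℝ) * (-1 / a) ^ k) * negXPoch k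

noncomputable def krawtchouk (n : ℕ) (p : ℝ) (N : ℕ) : Polynomial ℝ :=
  ∑ k ∈ Finset.range (n + 1),
    Polynomial.C (poch (-(n : ℝ)) k / ((k.factorial : ℝ) * poch (-(N : ℝ)) k) * (1 / p) ^ k) *
      negXPoch k

noncomputable def meixner (n : ℕ) (β c : ℝ) : Polynomial ℝ :=
  ∑ k ∈ Finset.range (n + 1),
    Polynomial.C (poch (-(n : ℝ)) k / ((k.factorial : ℝ) * poch β k) * (1 - 1 / c) ^ k) *
      negXPoch k

noncomputable def hahn (n : ℕ) (α β : ℝ) (N : ℕ) : Polynomial ℝ :=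
  ∑ k ∈ Finset.range (n + 1),
    Polynomial.C (poch (-(n : ℝ)) k * poch ((n : ℝ) + α + β + 1) k /
        ((k.factorial : ℝ) * poch (α + 1) k * poch (-(N : ℝ)) k)) * negXPoch k

def IsRootTuple {n : ℕ} (p : Polynomial ℝ) (x : Fin n → ℝ) : Prop :=
  StrictMono x ∧ ∀ y : ℝ, p.IsRoot y ↔ ∃ j, y = x j

lemma poch_zero (a : ℝ) : poch a 0 = 1 := by simp [poch]

lemma poch_succ (a : ℝ) (k : ℕ) : poch a (k + 1) = poch a k * (a + k) := by
  simp [poch, ascPochhammer_succ_eval]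

lemma poch_add (a : ℝ) (i j : ℕ) : poch a (i + j) = poch a i * poch (a + i) j := by
  simp [poch, ← ascPochhammer_mul]

lemma poch_pos {a : ℝ} (ha : 0 < a) (k : ℕ) : 0 < poch a k := ascPochhammer_pos k a ha

/-- `(-(k + i))_k = (-1)^k (k + i)! / i!`. -/
lemma poch_neg_add_mul_factorial (k i : ℕ) :
    poch (-((k + i : ℕ) : ℝ)) k * i.factorial = (-1) ^ k * (k + i).factorial := by
  induction i with
  | zero =>
    induction k with
    | zero => simp [poch_zero]
    | succ k ih =>
      have h := poch_add (-((k + 1 + 0 : ℕ) : ℝ)) 1 k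
      rw [add_comm 1 k] at h
      have e : -((k + 1 + 0 : ℕ) : ℝ) + (1 : ℕ) = -((k + 0 : ℕ) : ℝ) := by push_cast; ring
      rw [h, e, mul_assoc, ih, show (1 : ℕ) = 0 + 1 from rfl, poch_succ, poch_zero]
      push_cast [Nat.factorial_succ, pow_succ]
      simp
      ring
  | succ i ih =>
    have h1 := poch_add (-((k + (i + 1) : ℕ) : ℝ)) 1 k
    rw [add_comm 1 k] at h1
    have e : -((k + (i + 1) : ℕ) : ℝ) + (1 : ℕ) = -((k + i : ℕ) : ℝ) := by push_cast; ring
    rw [e, poch_succ, show (1 : ℕ) = 0 + 1 from rfl, poch_succ, poch_zero] at h1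
    rw [show k + (i + 1) = k + i + 1 from rfl, Nat.factorial_succ, Nat.factorial_succ] at *
    push_cast at *
    linear_combination -((i.factorial : ℝ)) * h1 + (k + i + 1 : ℝ) * ih

lemma poch_neg_eq_zero {j k : ℕ} (h : j < k) : poch (-(j : ℝ)) k = 0 := by
  obtain ⟨d, rfl⟩ := Nat.exists_eq_add_of_lt h
  rw [add_assoc, add_comm d 1, ← add_assoc, poch_add, poch_succ]
  simp

/-- Cross-ratio monotonicity of Pochhammer symbols. -/
lemma poch_mul_poch_lt {a b : ℝ} (ha : 0 < a) (hab : a < b) {i j : ℕ} (hij : i < j) :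
    poch b i * poch a j < poch b j * poch a i := by
  have hb : 0 < b := ha.trans hab
  induction j, hij using Nat.le_induction with
  | base =>
    rw [poch_succ, poch_succ]
    have := mul_pos (poch_pos hb i) (poch_pos ha i)
    nlinarith
  | succ j _ ih =>
    rw [poch_succ, poch_succ]
    have h1 := mul_lt_mul_of_pos_right ih (show 0 < a + j by positivity)
    have h2 : 0 < poch b j * poch a i := mul_pos (poch_pos hb j) (poch_pos ha i)
    nlinarith

/-- The Chu–Vandermonde identity for rising factorials. -/
lemma sum_antidiagonal_poch (a b : ℝ) (M : ℕ) :
    ∑ p ∈ Finset.HasAntidiagonal.antidiagonal M,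
      poch a p.1 / p.1.factorial * (poch b p.2 / p.2.factorial) =
      poch (a + b) M / M.factorial := by
  have step : ∀ (c : ℝ) (i : ℕ), ((i : ℝ) + 1) * (poch c (i + 1) / (i + 1).factorial) =
      (c + i) * (poch c i / i.factorial) := by
    intro c i
    rw [poch_succ, Nat.factorial_succ]
    push_cast
    field_simp
  induction M with
  | zero => simp [poch_zero]
  | succ M ih =>
    have hM : ((M : ℝ) + 1) ≠ 0 := by positivity
    apply mul_left_cancel₀ hM
    rw [step, ← ih, Finset.mul_sum, Finset.mul_sum]
    have hsplit : ∀ p ∈ Finset.HasAntidiagonal.antidiagonal (M + 1),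
        ((M : ℝ) + 1) * (poch a p.1 / p.1.factorial * (poch b p.2 / p.2.factorial)) =
        (p.1 : ℝ) * (poch a p.1 / p.1.factorial) * (poch b p.2 / p.2.factorial) +
        poch a p.1 / p.1.factorial * ((p.2 : ℝ) * (poch b p.2 / p.2.factorial)) := by
      intro p hp
      have : ((p.1 : ℝ) + p.2) = M + 1 := by
        exact_mod_cast Finset.HasAntidiagonal.mem_antidiagonal.mp hp
      rw [← this]; ring
    rw [Finset.sum_congr rfl hsplit, Finset.sum_add_distrib, Finset.Nat.sum_antidiagonal_succ,
      Finset.Nat.sum_antidiagonal_succ']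
    simp only [Nat.cast_zero, zero_mul, mul_zero, zero_add, Nat.cast_add, Nat.cast_one, step]
    rw [← Finset.sum_add_distrib]
    refine Finset.sum_congr rfl fun p hp => ?_
    have : ((p.1 : ℝ) + p.2) = M := by
      exact_mod_cast Finset.HasAntidiagonal.mem_antidiagonal.mp hp
    rw [← this]; ring

/-- Integration of polynomials against the discrete measure `∑_{j ≤ N} w j δ_j`. -/
noncomputable def discreteIntegral (w : ℕ → ℝ) (N : ℕ) : ℝ[X] →ₗ[ℝ] ℝ :=
  ∑ j ∈ Finset.range (N + 1), w j • Polynomial.leval (j : ℝ)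

lemma discreteIntegral_apply (w : ℕ → ℝ) (N : ℕ) (f : ℝ[X]) :
    discreteIntegral w N f = ∑ j ∈ Finset.range (N + 1), w j * f.eval (j : ℝ) := by
  simp [discreteIntegral]

/-- The weight of the Hahn polynomials at `j`. -/
noncomputable def hahnWeight (α β : ℝ) (N j : ℕ) : ℝ :=
  poch (α + 1) j / j.factorial * (poch (β + 1) (N - j) / (N - j).factorial)

lemma hahnWeight_pos {α β : ℝ} (hα : -1 < α) (hβ : -1 < β) (N j : ℕ) :
    0 < hahnWeight α β N j := by
  have := poch_pos (show 0 < α + 1 by linarith) j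
  have := poch_pos (show 0 < β + 1 by linarith) (N - j)
  unfold hahnWeight
  positivity

/-- The Pearson equation of the Hahn weight. -/
lemma hahnWeight_pearson (α β : ℝ) {N j : ℕ} (hj : j < N) :
    hahnWeight α β N j * ((N - j) * (j + α + 1)) =
      hahnWeight α β N (j + 1) * ((j + 1) * (β + N - j)) := by
  obtain ⟨l, rfl⟩ := Nat.exists_eq_add_of_lt hj
  rw [hahnWeight, hahnWeight, show j + l + 1 - j = l + 1 by omega,
    show j + l + 1 - (j + 1) = l by omega, poch_succ, poch_succ, Nat.factorial_succ,
    Nat.factorial_succ]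
  push_cast
  field_simp
  ring

/-- The polynomial `(β + 1 + N - x)_m`. -/
noncomputable def reflectedPoch (β : ℝ) (N m : ℕ) : ℝ[X] :=
  (ascPochhammer ℝ m).comp (C (β + 1 + N) - X)

lemma degree_reflectedPoch (β : ℝ) (N m : ℕ) : (reflectedPoch β N m).degree = m := by
  have h1 : (C (β + 1 + N) - X : ℝ[X]).natDegree = 1 := by
    rw [natDegree_sub_eq_right_of_natDegree_lt] <;> simp [-map_add]
  have h : (reflectedPoch β N m).natDegree = m := by
    rw [reflectedPoch, natDegree_comp, h1, ascPochhammer_natDegree, mul_one]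
  rcases Nat.eq_zero_or_pos m with rfl | hm
  · simp [reflectedPoch]
  · rw [degree_eq_iff_natDegree_eq_of_pos hm, h]

lemma hahn_moment (α β : ℝ) {N k : ℕ} (hk : k ≤ N) (m : ℕ) :
    discreteIntegral (hahnWeight α β N) N (negXPoch k * reflectedPoch β N m) =
      (-1) ^ k * poch (α + 1) k * poch (β + 1) m *
        (poch (α + β + 2 + m + k) (N - k) / (N - k).factorial) := by
  obtain ⟨M, rfl⟩ := Nat.exists_eq_add_of_le hk
  rw [discreteIntegral_apply, add_assoc, Finset.sum_range_add, Finset.sum_eq_zero, zero_add,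
    Nat.add_sub_cancel_left,
    show α + β + 2 + m + k = (α + 1 + k) + (β + 1 + m) by ring, ← sum_antidiagonal_poch,
    Finset.Nat.sum_antidiagonal_eq_sum_range_succ_mk, Finset.mul_sum]
  · refine Finset.sum_congr rfl fun i hi => ?_
    obtain ⟨l, rfl⟩ := Nat.exists_eq_add_of_le (Nat.lt_succ_iff.mp (Finset.mem_range.mp hi))
    have e1 : eval ((k + i : ℕ) : ℝ) (negXPoch k) = poch (-((k + i : ℕ) : ℝ)) k := by
      simp [negXPoch, poch]
    have e2 : eval ((k + i : ℕ) : ℝ) (reflectedPoch β (k + (i + l)) m) =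
        poch (β + 1 + l) m := by
      simp only [reflectedPoch, poch, eval_comp, eval_sub, eval_C, eval_X]
      congr 1; push_cast; ring
    have h1 := poch_neg_add_mul_factorial k i
    have h2 := poch_add (α + 1) k i
    have h3 := poch_add (β + 1) l m
    rw [add_comm l m, poch_add] at h3
    rw [eval_mul, e1, e2, hahnWeight, show k + (i + l) - (k + i) = l by omega,
      show i + l - i = l by omega, h2]
    have f1 : ((k + i).factorial : ℝ) ≠ 0 := by positivity
    have f2 : (i.factorial : ℝ) ≠ 0 := by positivity
    have f3 : (l.factorial : ℝ) ≠ 0 := by positivity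
    rw [← eq_div_iff f2] at h1
    rw [h1]
    field_simp
    linear_combination (-poch (α + 1) k * poch (α + 1 + k) i) * h3
  · intro j hj
    have : eval (j : ℝ) (negXPoch k) = poch (-(j : ℝ)) k := by simp [negXPoch, poch]
    rw [eval_mul, this, poch_neg_eq_zero (Finset.mem_range.mp hj), zero_mul, mul_zero]

lemma alternating_sum_choose_mul_poch (c : ℝ) {n d : ℕ} (hd : d < n) :
    ∑ k ∈ Finset.range (n + 1), (-1 : ℝ) ^ k * n.choose k * poch (c + k) d = 0 := by
  have hdeg : ((ascPochhammer ℝ d).comp (X + C c)).natDegree < n := by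
    rw [natDegree_comp, natDegree_X_add_C, ascPochhammer_natDegree, mul_one]; exact hd
  have h := congrFun (Polynomial.fwdDiff_iter_eq_zero_of_degree_lt hdeg) 0
  rw [fwdDiff_iter_eq_sum_shift] at h
  have h' := congrArg (fun t : ℝ => (-1) ^ n * t) h
  simp only [Pi.zero_apply, mul_zero, Finset.mul_sum] at h'
  rw [← h']
  refine Finset.sum_congr rfl fun k hk => ?_
  obtain ⟨l, rfl⟩ := Nat.exists_eq_add_of_le (Nat.lt_succ_iff.mp (Finset.mem_range.mp hk))
  have hl : ((-1 : ℝ) ^ l) * (-1) ^ l = 1 := by rw [← mul_pow]; simp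
  simp only [poch, eval_comp, eval_add, eval_X, eval_C, zsmul_eq_mul, Nat.add_sub_cancel_left]
  push_cast
  rw [nsmul_eq_mul, mul_one, zero_add, pow_add, add_comm c]
  linear_combination (-(-1 : ℝ) ^ k * ((k + l).choose k) *
    eval ((k : ℝ) + c) (ascPochhammer ℝ d)) * hl

lemma hahn_orthogonal_reflectedPoch {α β : ℝ} (hα : -1 < α) (hβ : -1 < β) {n N m : ℕ}
    (hnN : n ≤ N) (hm : m < n) :
    discreteIntegral (hahnWeight α β N) N (hahn n α β N * reflectedPoch β N m) = 0 := by
  obtain ⟨d, rfl⟩ := Nat.exists_eq_add_of_lt hm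
  set s : ℝ := α + β + 2 + m with hs
  have hspos : 0 < s := by have : (0 : ℝ) ≤ m := by positivity
                           linarith
  rw [hahn, Finset.sum_mul, map_sum]
  have key : ∀ k ∈ Finset.range (m + d + 1 + 1),
      discreteIntegral (hahnWeight α β N) N
        (C (poch (-((m + d + 1 : ℕ) : ℝ)) k * poch (((m + d + 1 : ℕ) : ℝ) + α + β + 1) k /
          ((k.factorial : ℝ) * poch (α + 1) k * poch (-(N : ℝ)) k)) * negXPoch k *
            reflectedPoch β N m) =
      (poch (β + 1) m * poch s N / (N.factorial * poch s d)) *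
        ((-1 : ℝ) ^ k * (m + d + 1).choose k * poch (s + k) d) := by
    intro k hk
    have hkn : k ≤ m + d + 1 := Nat.lt_succ_iff.mp (Finset.mem_range.mp hk)
    obtain ⟨M, rfl⟩ := Nat.exists_eq_add_of_le (hkn.trans hnN)
    rw [mul_assoc, ← smul_eq_C_mul, map_smul, smul_eq_mul, hahn_moment α β (Nat.le_add_right k M),
      Nat.add_sub_cancel_left]
    obtain ⟨l, hl⟩ := Nat.exists_eq_add_of_le hkn
    have h1 := poch_neg_add_mul_factorial k l
    have h2 := poch_neg_add_mul_factorial k M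
    have h3 : ((m + d + 1).choose k : ℝ) * k.factorial * l.factorial =
        (m + d + 1).factorial := by
      have := Nat.choose_mul_factorial_mul_factorial hkn
      rw [show m + d + 1 - k = l by omega] at this
      exact_mod_cast this
    rw [← hl] at h1
    have h4 := poch_add s k d
    rw [add_comm k d, poch_add] at h4
    have h5 := poch_add s k M
    have e : ((m + d + 1 : ℕ) : ℝ) + α + β + 1 = s + d := by rw [hs]; push_cast; ring
    rw [e]
    have p1 := (poch_pos (show 0 < α + 1 by linarith) k).ne'
    have p2 := (poch_pos hspos d).ne'
    have f1 : (M.factorial : ℝ) ≠ 0 := by positivity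
    have f2 : (l.factorial : ℝ) ≠ 0 := by positivity
    have f3 : (k.factorial : ℝ) ≠ 0 := by positivity
    have f4 : ((k + M).factorial : ℝ) ≠ 0 := by positivity
    rw [← h3] at h1
    have h1' : poch (-((m + d + 1 : ℕ) : ℝ)) k =
        (-1) ^ k * ((m + d + 1).choose k * k.factorial) := by
      apply mul_right_cancel₀ f2
      rw [h1]; ring
    rw [← eq_div_iff f1] at h2
    rw [h1', h2, h5, ← hs]
    field_simp
    linear_combination ((m + d + 1).choose k * poch (β + 1) m * poch (s + k) M) * h4
  rw [Finset.sum_congr rfl key, ← Finset.mul_sum,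
    alternating_sum_choose_mul_poch s (by omega), mul_zero]

lemma hahn_orthogonal {α β : ℝ} (hα : -1 < α) (hβ : -1 < β) {n N : ℕ} (hnN : n ≤ N)
    {g : ℝ[X]} (hg : g.degree < n) :
    discreteIntegral (hahnWeight α β N) N (hahn n α β N * g) = 0 := by
  suffices H : ∀ m ≤ n, ∀ g : ℝ[X], g.degree < m →
      discreteIntegral (hahnWeight α β N) N (hahn n α β N * g) = 0 from H n le_rfl g hg
  intro m
  induction m with
  | zero =>
    intro _ g hg
    have : g = 0 := by simpa using hg
    simp [this]
  | succ m ih =>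
    intro hm g hg
    have hb := degree_reflectedPoch β N m
    have hlc : (reflectedPoch β N m).coeff m ≠ 0 := coeff_ne_zero_of_eq_degree hb
    set c := g.coeff m / (reflectedPoch β N m).coeff m with hc
    have hlow : (g - c • reflectedPoch β N m).degree < m := by
      rw [degree_lt_iff_coeff_zero]
      intro i hi
      rcases hi.eq_or_lt with rfl | hi
      · simp [hc, hlc]
      · have h1 : g.coeff i = 0 := coeff_eq_zero_of_degree_lt
          (hg.trans_le (by exact_mod_cast hi))
        have h2 : (reflectedPoch β N m).coeff i = 0 := coeff_eq_zero_of_degree_lt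
          (by rw [hb]; exact_mod_cast hi)
        simp [h1, h2]
    have h := ih (by omega) _ hlow
    rw [mul_sub, map_sub, mul_smul_comm, map_smul,
      hahn_orthogonal_reflectedPoch hα hβ hnN (by omega), smul_zero, sub_zero] at h
    exact h

lemma natDegree_hahn_le (n : ℕ) (α β : ℝ) (N : ℕ) : (hahn n α β N).natDegree ≤ n := by
  refine natDegree_sum_le_of_forall_le _ _ fun k hk => ?_
  refine (natDegree_C_mul_le _ _).trans ?_
  rw [negXPoch, natDegree_comp, natDegree_neg, natDegree_X, ascPochhammer_natDegree, mul_one]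
  exact Nat.lt_succ_iff.mp (Finset.mem_range.mp hk)

lemma hahn_ne_zero (n : ℕ) (α β : ℝ) (N : ℕ) : hahn n α β N ≠ 0 := by
  intro h
  have h0 : (hahn n α β N).eval 0 = 1 := by
    rw [hahn, eval_finsetSum, Finset.sum_eq_single 0]
    · simp [negXPoch, poch]
    · intro k _ hk
      simp [negXPoch, hk]
    · simp
  simp [h] at h0

/-- Gauss quadrature at the zeros of an orthogonal polynomial. -/
lemma gauss_quadrature {w : ℕ → ℝ} {N n : ℕ} {x : Fin n → ℝ} (hx : Function.Injective x)
    (hO : ∀ g : ℝ[X], g.degree < n →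
      discreteIntegral w N (Lagrange.nodal Finset.univ x * g) = 0)
    {f : ℝ[X]} (hf : f.natDegree < 2 * n) :
    discreteIntegral w N f =
      ∑ k, discreteIntegral w N (Lagrange.basis Finset.univ x k) * f.eval (x k) := by
  set P := Lagrange.nodal Finset.univ x with hP
  have hmon : P.Monic := Lagrange.nodal_monic
  have hcard : (Finset.univ : Finset (Fin n)).card = n := by simp
  have hPd : P.natDegree = n := by rw [hP, Lagrange.natDegree_nodal, hcard]
  have hq : (f /ₘ P).degree < n := by
    rcases eq_or_ne (f /ₘ P) 0 with h | h
    · rw [h, degree_zero]; exact WithBot.bot_lt_coe _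
    · rw [degree_eq_natDegree h, natDegree_divByMonic f hmon, hPd]
      exact_mod_cast (by omega : f.natDegree - n < n)
  have hr : (f %ₘ P) = Lagrange.interpolate Finset.univ x (fun k => f.eval (x k)) := by
    apply Lagrange.eq_interpolate_of_eval_eq _ hx.injOn
    · have := degree_modByMonic_lt f hmon
      rwa [hP, Lagrange.degree_nodal] at this
    · intro i _
      conv_rhs => rw [← modByMonic_add_div f P]
      rw [eval_add, eval_mul, hP, Lagrange.eval_nodal_at_node (Finset.mem_univ i), zero_mul,
        add_zero]
  conv_lhs => rw [← modByMonic_add_div f P]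
  rw [map_add, hO _ hq, add_zero, hr, Lagrange.interpolate_apply, map_sum]
  refine Finset.sum_congr rfl fun k _ => ?_
  rw [← smul_eq_C_mul, map_smul, smul_eq_mul, mul_comm]

lemma gauss_weight_pos {w : ℕ → ℝ} {N n : ℕ} (hw : ∀ j ≤ N, 0 < w j) (hnN : n ≤ N)
    {x : Fin n → ℝ} (hx : Function.Injective x)
    (hO : ∀ g : ℝ[X], g.degree < n →
      discreteIntegral w N (Lagrange.nodal Finset.univ x * g) = 0) (k : Fin n) :
    0 < discreteIntegral w N (Lagrange.basis Finset.univ x k) := by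
  set l := Lagrange.basis Finset.univ x k with hl
  have hld : l.natDegree = n - 1 := by
    rw [hl, Lagrange.natDegree_basis hx.injOn (Finset.mem_univ k)]; simp
  have hn := k.pos
  have hsq : discreteIntegral w N (l ^ 2) = discreteIntegral w N l := by
    rw [gauss_quadrature hx hO (natDegree_pow_le.trans_lt (by rw [hld]; omega)),
      Finset.sum_eq_single k]
    · rw [eval_pow, hl, Lagrange.eval_basis_self hx.injOn (Finset.mem_univ k)]; simp
    · intro i _ hi
      rw [eval_pow, hl, Lagrange.eval_basis_of_ne hi.symm (Finset.mem_univ i)]; simp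
    · simp
  rw [← hsq, discreteIntegral_apply]
  have hnn : ∀ j ∈ Finset.range (N + 1), 0 ≤ w j * (l ^ 2).eval (j : ℝ) := fun j hj => by
    rw [eval_pow]
    exact mul_nonneg (hw j (Nat.lt_succ_iff.mp (Finset.mem_range.mp hj))).le (sq_nonneg _)
  refine (Finset.sum_nonneg hnn).lt_of_ne' fun h0 => ?_
  rw [Finset.sum_eq_zero_iff_of_nonneg hnn] at h0
  refine Lagrange.basis_ne_zero hx.injOn (Finset.mem_univ k)
    (eq_zero_of_natDegree_lt_card_of_eval_eq_zero' l
      ((Finset.range (N + 1)).map Nat.castEmbedding) ?_ ?_)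
  · intro y hy
    obtain ⟨j, hj, rfl⟩ := Finset.mem_map.mp hy
    have := h0 j hj
    rw [eval_pow] at this
    simpa [(hw j (Nat.lt_succ_iff.mp (Finset.mem_range.mp hj))).ne'] using this
  · rw [Finset.card_map, Finset.card_range, hld]; omega

/-- Markov's monotonicity theorem: zeros move to the right when the weight is multiplied by an
increasing function. -/
lemma zeros_lt_of_weight_ratio {w₁ w₂ : ℕ → ℝ} {N n : ℕ} (hnN : n ≤ N)
    (hw₁ : ∀ j ≤ N, 0 < w₁ j) (hw₂ : ∀ j ≤ N, 0 < w₂ j)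
    (hr : ∀ i j, i < j → j ≤ N → w₂ i * w₁ j < w₂ j * w₁ i)
    {x y : Fin n → ℝ} (hx : StrictMono x) (hy : StrictMono y)
    (hOx : ∀ g : ℝ[X], g.degree < n →
      discreteIntegral w₁ N (Lagrange.nodal Finset.univ x * g) = 0)
    (hOy : ∀ g : ℝ[X], g.degree < n →
      discreteIntegral w₂ N (Lagrange.nodal Finset.univ y * g) = 0)
    (j : Fin n) : x j < y j := by
  by_contra! hle
  have hn := j.pos
  set t := x j with ht
  set z : Fin n → ℝ := fun k => if k < j then x k else y k with hz
  set r : ℝ[X] := Lagrange.nodal (Finset.univ.erase j) z with hrdef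
  have hr0 : r ≠ 0 := Lagrange.nodal_ne_zero
  have hrd : r.natDegree = n - 1 := by
    rw [hrdef, Lagrange.natDegree_nodal, Finset.card_erase_of_mem (Finset.mem_univ j)]; simp
  set f : ℝ[X] := (X - C t) * r ^ 2 with hf
  have hfd : f.natDegree < 2 * n := by
    refine natDegree_mul_le.trans_lt ?_
    rw [natDegree_X_sub_C, natDegree_pow, hrd]; omega
  have hfeval : ∀ s, f.eval s = (s - t) * (r.eval s) ^ 2 := fun s => by simp [hf]
  have hI₁ : 0 ≤ discreteIntegral w₁ N f := by
    rw [gauss_quadrature hx.injective hOx hfd]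
    refine Finset.sum_nonneg fun k _ => mul_nonneg
      (gauss_weight_pos hw₁ hnN hx.injective hOx k).le ?_
    rw [hfeval]
    rcases lt_or_ge k j with hk | hk
    · have : r.eval (x k) = 0 := by
        have := Lagrange.eval_nodal_at_node (v := z)
          (Finset.mem_erase.mpr ⟨hk.ne, Finset.mem_univ k⟩)
        simpa [hz, hk] using this
      simp [this]
    · exact mul_nonneg (sub_nonneg.mpr (hx.monotone hk)) (sq_nonneg _)
  have hI₂ : discreteIntegral w₂ N f ≤ 0 := by
    rw [gauss_quadrature hy.injective hOy hfd]
    refine Finset.sum_nonpos fun k _ => mul_nonpos_of_nonneg_of_nonpos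
      (gauss_weight_pos hw₂ hnN hy.injective hOy k).le ?_
    rw [hfeval]
    rcases lt_or_ge j k with hk | hk
    · have : r.eval (y k) = 0 := by
        have := Lagrange.eval_nodal_at_node (v := z)
          (Finset.mem_erase.mpr ⟨hk.ne', Finset.mem_univ k⟩)
        simpa [hz, hk.not_gt] using this
      simp [this]
    · exact mul_nonpos_of_nonpos_of_nonneg (sub_nonpos.mpr ((hy.monotone hk).trans hle))
        (sq_nonneg _)
  set m := min ⌊t⌋₊ N with hm
  have hmN : m ≤ N := min_le_right _ _
  have hpos : ∀ i ≤ N, i ≠ m → 0 < (i - t) * (w₂ i * w₁ m - w₂ m * w₁ i) := by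
    intro i hi him
    rcases him.lt_or_gt with h | h
    · refine mul_pos_of_neg_of_neg ?_ (sub_neg.mpr (hr i m h hmN))
      rw [sub_neg]
      exact (Nat.lt_of_lt_floor (h.trans_le (min_le_left _ _)))
    · refine mul_pos ?_ (sub_pos.mpr (hr m i h hi))
      rw [sub_pos, ← Nat.floor_lt' (by omega)]
      rcases min_lt_iff.mp h with h | h <;> omega
  have hnn : ∀ i ∈ Finset.range (N + 1),
      0 ≤ (i - t) * (w₂ i * w₁ m - w₂ m * w₁ i) * (r.eval (i : ℝ)) ^ 2 := by
    intro i hi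
    refine mul_nonneg ?_ (sq_nonneg _)
    rcases eq_or_ne i m with rfl | him
    · simp [mul_comm]
    · exact (hpos i (Nat.lt_succ_iff.mp (Finset.mem_range.mp hi)) him).le
  have hsum : ∑ i ∈ Finset.range (N + 1),
      (i - t) * (w₂ i * w₁ m - w₂ m * w₁ i) * (r.eval (i : ℝ)) ^ 2 =
      w₁ m * discreteIntegral w₂ N f - w₂ m * discreteIntegral w₁ N f := by
    rw [discreteIntegral_apply, discreteIntegral_apply, Finset.mul_sum, Finset.mul_sum,
      ← Finset.sum_sub_distrib]
    refine Finset.sum_congr rfl fun i _ => ?_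
    rw [hfeval]; ring
  have h0 := le_antisymm (hsum.trans_le (by
    nlinarith [mul_nonneg (hw₂ m hmN).le hI₁, mul_nonneg (hw₁ m hmN).le (neg_nonneg.mpr hI₂)]))
    (Finset.sum_nonneg hnn)
  rw [Finset.sum_eq_zero_iff_of_nonneg hnn] at h0
  refine hr0 (eq_zero_of_natDegree_lt_card_of_eval_eq_zero' r
    (((Finset.range (N + 1)).erase m).map Nat.castEmbedding) ?_ ?_)
  · intro s hs
    obtain ⟨i, hi, rfl⟩ := Finset.mem_map.mp hs
    obtain ⟨him, hi⟩ := Finset.mem_erase.mp hi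
    have := h0 i hi
    simpa [(hpos i (Nat.lt_succ_iff.mp (Finset.mem_range.mp hi)) him).ne'] using this
  · rw [Finset.card_map, Finset.card_erase_of_mem (Finset.mem_range.mpr (by omega)),
      Finset.card_range, hrd]
    omega

/-- On a bounded interval the sign changes of a polynomial are cancelled by finitely many of its
linear factors. -/
lemma exists_finset_mul_constant_sign {a b : ℝ} (hab : a < b) {f : ℝ[X]} (hf : f ≠ 0) :
    ∃ Z : Finset ℝ, (∀ z ∈ Z, z ∈ Set.Ioo a b) ∧ Lagrange.nodal Z id ∣ f ∧
      ((∀ x ∈ Set.Icc a b, 0 ≤ (f * Lagrange.nodal Z id).eval x) ∨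
       (∀ x ∈ Set.Icc a b, (f * Lagrange.nodal Z id).eval x ≤ 0)) := by
  induction hd : f.natDegree generalizing f with
  | zero =>
    refine ⟨∅, by simp, by simp, ?_⟩
    rw [natDegree_eq_zero.mp hd |>.choose_spec.symm]
    rcases le_total 0 (natDegree_eq_zero.mp hd).choose with h | h
    · left; simp [h]
    · right; simp [h]
  | succ d ih =>
    by_cases hroot : ∃ z ∈ Set.Ioo a b, f.IsRoot z
    · obtain ⟨z, hz, hfz⟩ := hroot
      obtain ⟨g, rfl⟩ := dvd_iff_isRoot.mpr hfz
      have hg : g ≠ 0 := right_ne_zero_of_mul hf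
      have hgd : g.natDegree = d := by
        rw [natDegree_mul (X_sub_C_ne_zero z) hg, natDegree_X_sub_C] at hd; omega
      obtain ⟨Z, hZ, hdvd, hsign⟩ := ih hg hgd
      by_cases hzZ : z ∈ Z
      · have hnod := Lagrange.nodal_eq_mul_nodal_erase (v := (id : ℝ → ℝ)) hzZ
        rw [id] at hnod
        refine ⟨Z.erase z, fun y hy => hZ y (Finset.mem_of_mem_erase hy), ?_, ?_⟩
        · exact ((Dvd.intro_left _ hnod.symm).trans hdvd).mul_left _
        · rwa [show (X - C z) * g * Lagrange.nodal (Z.erase z) id = g * Lagrange.nodal Z id by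
            rw [hnod]; ring]
      · have hnod := Lagrange.nodal_insert_eq_nodal (v := (id : ℝ → ℝ)) hzZ
        rw [id] at hnod
        refine ⟨insert z Z, ?_, ?_, ?_⟩
        · intro y hy
          rcases Finset.mem_insert.mp hy with rfl | hy
          exacts [hz, hZ y hy]
        · rw [hnod]; exact mul_dvd_mul_left _ hdvd
        · have e : ∀ x, ((X - C z) * g * Lagrange.nodal (insert z Z) id).eval x =
              (x - z) ^ 2 * (g * Lagrange.nodal Z id).eval x := by
            intro x
            rw [hnod]; simp only [eval_mul, eval_sub, eval_X, eval_C]; ring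
          simp only [e]
          exact hsign.imp (fun h x hx => mul_nonneg (sq_nonneg _) (h x hx))
            (fun h x hx => mul_nonpos_of_nonneg_of_nonpos (sq_nonneg _) (h x hx))
    · refine ⟨∅, by simp, by simp, ?_⟩
      simp only [Lagrange.nodal_empty, mul_one]
      have hcl : Set.Icc a b = closure (Set.Ioo a b) := (closure_Ioo hab.ne).symm
      have hsub : (∀ x ∈ Set.Ioo a b, 0 ≤ f.eval x) ∨ (∀ x ∈ Set.Ioo a b, f.eval x ≤ 0) := by
        by_contra! h
        obtain ⟨⟨u, hu, hfu⟩, v, hv, hfv⟩ := h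
        obtain ⟨z, hz, hfz⟩ := isPreconnected_Ioo.intermediate_value hu hv
          f.continuous.continuousOn (show (0 : ℝ) ∈ Set.Icc (f.eval u) (f.eval v) from
            ⟨hfu.le, hfv.le⟩)
        exact hroot ⟨z, hz, hfz⟩
      rw [hcl]
      exact hsub.imp
        (fun h => closure_minimal h (isClosed_le continuous_const f.continuous))
        (fun h => closure_minimal h (isClosed_le f.continuous continuous_const))

/-- An orthogonal polynomial has all its zeros real, simple and inside the interval spanned by the
support of the measure. -/
lemma exists_nodal_eq_of_orthogonal {w : ℕ → ℝ} {N n : ℕ} (hN : 0 < N) (hnN : n ≤ N)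
    (hw : ∀ j ≤ N, 0 < w j) {f : ℝ[X]} (hf : f ≠ 0) (hfd : f.natDegree ≤ n)
    (hO : ∀ g : ℝ[X], g.degree < n → discreteIntegral w N (f * g) = 0) :
    ∃ x : Fin n → ℝ, StrictMono x ∧ (∀ j, x j ∈ Set.Ioo (0 : ℝ) N) ∧
      ∃ c : ℝ, c ≠ 0 ∧ f = C c * Lagrange.nodal Finset.univ x := by
  obtain ⟨Z, hZ, hdvd, hsign⟩ :=
    exists_finset_mul_constant_sign (show (0 : ℝ) < N by exact_mod_cast hN) hf
  have hcard : Z.card = n := by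
    refine le_antisymm ?_ ?_
    · have := natDegree_le_of_dvd hdvd hf
      rw [Lagrange.natDegree_nodal] at this; omega
    · by_contra! hlt
      have h0 := hO (Lagrange.nodal Z id) (by rw [Lagrange.degree_nodal]; exact_mod_cast hlt)
      rw [discreteIntegral_apply] at h0
      have hmem : ∀ j ∈ Finset.range (N + 1), (j : ℝ) ∈ Set.Icc (0 : ℝ) N := fun j hj =>
        ⟨by positivity, by exact_mod_cast Nat.lt_succ_iff.mp (Finset.mem_range.mp hj)⟩
      have hw' : ∀ j ∈ Finset.range (N + 1), 0 < w j := fun j hj =>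
        hw j (Nat.lt_succ_iff.mp (Finset.mem_range.mp hj))
      have hz : ∀ j ∈ Finset.range (N + 1), w j * (f * Lagrange.nodal Z id).eval (j : ℝ) = 0 := by
        rcases hsign with h | h
        · exact (Finset.sum_eq_zero_iff_of_nonneg fun j hj =>
            mul_nonneg (hw' j hj).le (h _ (hmem j hj))).mp h0
        · exact (Finset.sum_eq_zero_iff_of_nonpos fun j hj =>
            mul_nonpos_of_nonneg_of_nonpos (hw' j hj).le (h _ (hmem j hj))).mp h0
      refine hf (eq_zero_of_natDegree_lt_card_of_eval_eq_zero' f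
        ((Finset.range (N + 1)).map Nat.castEmbedding) ?_ ?_)
      · intro y hy
        obtain ⟨j, hj, rfl⟩ := Finset.mem_map.mp hy
        have h1 := (mul_eq_zero.mp (hz j hj)).resolve_left (hw' j hj).ne'
        rw [eval_mul] at h1
        rcases mul_eq_zero.mp h1 with h1 | h1
        exacts [h1, eval_eq_zero_of_dvd_of_eval_eq_zero hdvd h1]
      · rw [Finset.card_map, Finset.card_range]; omega
  have hnod : Lagrange.nodal Finset.univ (Z.orderEmbOfFin hcard) = Lagrange.nodal Z id := by
    rw [Lagrange.nodal_eq, Lagrange.nodal_eq]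
    conv_rhs => rw [← Finset.image_orderEmbOfFin_univ Z hcard]
    rw [Finset.prod_image (Z.orderEmbOfFin hcard).injective.injOn]
    rfl
  refine ⟨Z.orderEmbOfFin hcard, (Z.orderEmbOfFin hcard).strictMono,
    fun j => hZ _ (Z.orderEmbOfFin_mem hcard j), ?_⟩
  obtain ⟨q, hq⟩ := hdvd
  have hq0 : q ≠ 0 := by rintro rfl; exact hf (by simpa using hq)
  have hqd : q.natDegree = 0 := by
    have := congrArg natDegree hq
    rw [natDegree_mul Lagrange.nodal_ne_zero hq0, Lagrange.natDegree_nodal] at this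
    omega
  obtain ⟨c, rfl⟩ := natDegree_eq_zero.mp hqd
  refine ⟨c, by simpa using hq0, ?_⟩
  rw [hnod, hq, mul_comm]

lemma discreteIntegral_hahn_shift (α β : ℝ) (N : ℕ) (f : ℝ[X]) :
    discreteIntegral (hahnWeight α β N) N
        (((C (N : ℝ) - X) * (X + C (α + 1))) * f.comp (X + C 1)) =
      discreteIntegral (hahnWeight α β N) N ((X * (C (β + N + 1) - X)) * f) := by
  rw [discreteIntegral_apply, discreteIntegral_apply, Finset.sum_range_succ,
    Finset.sum_range_succ']
  simp only [eval_mul, eval_sub, eval_add, eval_X, eval_C, eval_comp, sub_self, zero_mul, mul_zero,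
    add_zero, Nat.cast_zero]
  refine Finset.sum_congr rfl fun j hj => ?_
  have h := hahnWeight_pearson α β (Finset.mem_range.mp hj)
  push_cast
  linear_combination (eval ((j : ℝ) + 1) f) * h

lemma natDegree_quadratic_mul_comp_add_sq_mul_le (a u v : ℝ) {f : ℝ[X]} {d : ℕ}
    (hf : f.natDegree ≤ d) :
    ((-X ^ 2 + C u * X + C v) * f.comp (X + C a) + X ^ 2 * f).natDegree ≤ d + 1 := by
  have hcomp : (f.comp (X + C a)).natDegree = f.natDegree := by
    rw [natDegree_comp, natDegree_X_add_C, mul_one]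
  have hlin : (C u * X + C v : ℝ[X]).natDegree ≤ 1 := natDegree_linear_le
  rw [show (-X ^ 2 + C u * X + C v) * f.comp (X + C a) + X ^ 2 * f =
    (C u * X + C v) * f.comp (X + C a) - X ^ 2 * (f.comp (X + C a) - f) by ring]
  refine (natDegree_sub_le _ _).trans (max_le (natDegree_mul_le.trans (by omega)) ?_)
  rcases eq_or_ne (f.comp (X + C a) - f) 0 with h0 | h0
  · rw [h0]; simp
  · have hf0 : f ≠ 0 := by rintro rfl; simp at h0
    have hlt : (f.comp (X + C a) - f).degree < f.degree := by
      refine degree_sub_lt_right ?_ hf0 ?_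
      · exact degree_taylor f a
      · exact leadingCoeff_taylor a f
    have := natDegree_lt_natDegree h0 hlt
    refine natDegree_mul_le.trans ?_
    rw [natDegree_X_pow]; omega

/-- The values of `P` at the shifted nodes `x k + 1`, weighted by the Gauss weights and by
`(N - x k) (x k + α + 1)`, are orthogonal to polynomials of degree at most `n - 2`. -/
lemma sum_gauss_weight_mul_shift_eq_zero {α β : ℝ} {N n : ℕ} (hn : 2 ≤ n) {x : Fin n → ℝ}
    (hx : Function.Injective x)
    (hO : ∀ g : ℝ[X], g.degree < n →
      discreteIntegral (hahnWeight α β N) N (Lagrange.nodal Finset.univ x * g) = 0)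
    {g : ℝ[X]} (hg : g.natDegree + 2 ≤ n) :
    ∑ k, discreteIntegral (hahnWeight α β N) N (Lagrange.basis Finset.univ x k) *
      ((N - x k) * (x k + (α + 1)) * (Lagrange.nodal Finset.univ x).eval (x k + 1) *
        g.eval (x k)) = 0 := by
  set P := Lagrange.nodal Finset.univ x with hP
  have hPd : P.natDegree ≤ n := by rw [hP, Lagrange.natDegree_nodal]; simp
  set D : ℝ[X] := (C (N : ℝ) - X) * (X + C (α + 1)) with hD
  set E : ℝ[X] := X * (C (β + N + 1) - X) with hE
  have hD' : D = -X ^ 2 + C (N - (α + 1)) * X + C (N * (α + 1)) := by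
    rw [hD, C_sub, C_mul]; ring
  have hE' : E = -X ^ 2 + C (β + N + 1) * X + C 0 := by rw [hE, C_0]; ring
  have hdeg : ((D * P.comp (X + C 1) + X ^ 2 * P) * g).natDegree < 2 * n := by
    have := natDegree_quadratic_mul_comp_add_sq_mul_le 1 (N - (α + 1)) (N * (α + 1)) hPd
    rw [← hD'] at this
    exact natDegree_mul_le.trans_lt (by omega)
  have hzero : discreteIntegral (hahnWeight α β N) N
      ((D * P.comp (X + C 1) + X ^ 2 * P) * g) = 0 := by
    have e1 : (D * P.comp (X + C 1) + X ^ 2 * P) * g =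
        D * (P * g.comp (X + C (-1))).comp (X + C 1) + P * (X ^ 2 * g) := by
      have : (g.comp (X + C (-1))).comp (X + C 1) = g := by
        rw [comp_assoc]; simp
      rw [mul_comp, this]; ring
    have e2 : E * (P * g.comp (X + C (-1))) + P * (X ^ 2 * g) =
        P * (E * g.comp (X + C (-1)) + X ^ 2 * g) := by ring
    rw [e1, map_add, hD, discreteIntegral_hahn_shift, ← hE, ← map_add, e2]
    refine hO _ ?_
    have := natDegree_quadratic_mul_comp_add_sq_mul_le (-1) (β + N + 1) 0
      (show g.natDegree ≤ n - 2 by omega)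
    rw [← hE'] at this
    exact degree_le_natDegree.trans_lt (Nat.cast_lt.mpr (by omega))
  rw [gauss_quadrature hx hO hdeg] at hzero
  rw [← hzero]
  refine Finset.sum_congr rfl fun k _ => ?_
  have : P.eval (x k) = 0 := Lagrange.eval_nodal_at_node (Finset.mem_univ k)
  simp [this, hD]

/-- Consecutive zeros of a polynomial orthogonal with respect to the Hahn weight are more than `1`
apart. -/
lemma hahn_nodes_gap {α β : ℝ} (hα : -1 < α) (hβ : -1 < β) {N n : ℕ} (hnN : n ≤ N)
    {x : Fin n → ℝ} (hx : StrictMono x) (hxI : ∀ j, x j ∈ Set.Ioo (0 : ℝ) N)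
    (hO : ∀ g : ℝ[X], g.degree < n →
      discreteIntegral (hahnWeight α β N) N (Lagrange.nodal Finset.univ x * g) = 0) :
    GapGt 1 x := by
  suffices H : ∀ m i : ℕ, n ≤ m + (i + 1) → ∀ hi : i + 1 < n,
      x ⟨i + 1, hi⟩ - x ⟨i, Nat.lt_of_succ_lt hi⟩ > 1 from
    fun i hi => H n i (by omega) hi
  intro m
  induction m with
  | zero => intro i _ hi; omega
  | succ m ih =>
    intro i him hi
    by_contra! hle
    set a : Fin n := ⟨i, Nat.lt_of_succ_lt hi⟩ with ha
    set b : Fin n := ⟨i + 1, hi⟩ with hb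
    have hab : a < b := by rw [Fin.lt_def]; simp [ha, hb]
    have hxab := hx hab
    have habove : ∀ k, b < k → x b + 1 < x k := by
      intro k hk
      have hk' : i + 1 < k.val := hk
      have hi2 : i + 1 + 1 < n := by omega
      have h1 := ih (i + 1) (by omega) hi2
      have h2 : x ⟨i + 1 + 1, hi2⟩ ≤ x k := hx.monotone (by rw [Fin.le_def]; simp; omega)
      change x ⟨i + 1 + 1, hi2⟩ - x b > 1 at h1
      linarith
    have hcases : ∀ k, k < a ∨ k = a ∨ k = b ∨ b < k := by
      intro k
      simp only [ha, hb, Fin.lt_def, Fin.ext_iff]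
      omega
    set P := Lagrange.nodal Finset.univ x with hP
    set S : Finset (Fin n) := (Finset.univ.erase a).erase b with hS
    set g := Lagrange.nodal S x with hg
    have hgd : g.natDegree + 2 ≤ n := by
      rw [hg, Lagrange.natDegree_nodal, hS, Finset.card_erase_of_mem
        (Finset.mem_erase.mpr ⟨hab.ne', Finset.mem_univ b⟩),
        Finset.card_erase_of_mem (Finset.mem_univ a), Finset.card_univ, Fintype.card_fin]
      omega
    have hsum := sum_gauss_weight_mul_shift_eq_zero (α := α) (β := β) (by omega) hx.injective hO hgd
    have hga : ∀ k, k ≠ a → k ≠ b → g.eval (x k) = 0 := fun k hka hkb =>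
      Lagrange.eval_nodal_at_node (Finset.mem_erase.mpr
        ⟨hkb, Finset.mem_erase.mpr ⟨hka, Finset.mem_univ k⟩⟩)
    rw [Finset.sum_eq_add a b hab.ne (fun k _ hk => by rw [hga k hk.1 hk.2]; ring)
      (by simp) (by simp)] at hsum
    have hgg : 0 < g.eval (x a) * g.eval (x b) := by
      rw [hg, Lagrange.eval_nodal, Lagrange.eval_nodal, ← Finset.prod_mul_distrib]
      refine Finset.prod_pos fun k hk => ?_
      obtain ⟨hkb, hk⟩ := Finset.mem_erase.mp hk
      obtain ⟨hka, -⟩ := Finset.mem_erase.mp hk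
      rcases hcases k with h | h | h | h
      · have := hx h
        exact mul_pos (by linarith) (by linarith)
      · exact absurd h hka
      · exact absurd h hkb
      · have := hx h
        exact mul_pos_of_neg_of_neg (by linarith) (by linarith)
    have hPP : 0 ≤ P.eval (x a + 1) * P.eval (x b + 1) := by
      rw [hP, Lagrange.eval_nodal, Lagrange.eval_nodal, ← Finset.prod_mul_distrib]
      refine Finset.prod_nonneg fun k _ => ?_
      rcases hcases k with h | rfl | rfl | h
      · have := hx h
        exact mul_nonneg (by linarith) (by linarith)
      · exact mul_nonneg (by linarith) (by linarith)
      · exact mul_nonneg (by linarith) (by linarith)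
      · have := habove k h
        exact mul_nonneg_of_nonpos_of_nonpos (by linarith) (by linarith)
    have hPb : P.eval (x b + 1) ≠ 0 := by
      rw [hP, Lagrange.eval_nodal, Finset.prod_ne_zero_iff]
      intro k _
      rcases hcases k with h | rfl | rfl | h
      · have := hx h
        linarith
      · linarith
      · simp
      · have := habove k h
        linarith
    have hcoef : ∀ k, 0 < discreteIntegral (hahnWeight α β N) N (Lagrange.basis Finset.univ x k) *
        ((N - x k) * (x k + (α + 1))) := fun k =>
      mul_pos (gauss_weight_pos (fun j _ => hahnWeight_pos hα hβ N j) hnN hx.injective hO k)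
        (mul_pos (sub_pos.mpr (hxI k).2) (by linarith [(hxI k).1]))
    have hA := hcoef a
    have hB := hcoef b
    set A := discreteIntegral (hahnWeight α β N) N (Lagrange.basis Finset.univ x a) *
      ((N - x a) * (x a + (α + 1))) with hAdef
    set B := discreteIntegral (hahnWeight α β N) N (Lagrange.basis Finset.univ x b) *
      ((N - x b) * (x b + (α + 1))) with hBdef
    have hsum' : A * (P.eval (x a + 1) * g.eval (x a)) +
        B * (P.eval (x b + 1) * g.eval (x b)) = 0 := by
      rw [← hsum, hAdef, hBdef]; ring
    have hprod : 0 ≤ (A * (P.eval (x a + 1) * g.eval (x a))) *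
        (B * (P.eval (x b + 1) * g.eval (x b))) := by
      rw [show (A * (P.eval (x a + 1) * g.eval (x a))) *
        (B * (P.eval (x b + 1) * g.eval (x b))) = (A * B) *
          ((P.eval (x a + 1) * P.eval (x b + 1)) * (g.eval (x a) * g.eval (x b))) by ring]
      positivity
    have hne : B * (P.eval (x b + 1) * g.eval (x b)) ≠ 0 :=
      mul_ne_zero hB.ne' (mul_ne_zero hPb (right_ne_zero_of_mul hgg.ne'))
    rw [eq_neg_of_add_eq_zero_left hsum'] at hprod
    nlinarith [mul_self_pos.mpr hne]

/-- The zeros of a Hahn polynomial, listed increasingly, are the zeros of a monic polynomial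
orthogonal with respect to the Hahn weight. -/
lemma hahn_orthogonal_nodal_of_isRootTuple {α β : ℝ} (hα : -1 < α) (hβ : -1 < β) {n N : ℕ}
    (hnN : n ≤ N) {x : Fin n → ℝ} (hx : IsRootTuple (hahn n α β N) x) {g : ℝ[X]}
    (hg : g.degree < n) :
    discreteIntegral (hahnWeight α β N) N (Lagrange.nodal Finset.univ x * g) = 0 := by
  have hdvd : Lagrange.nodal Finset.univ x ∣ hahn n α β N := by
    rw [Lagrange.nodal_eq]
    refine Finset.prod_dvd_of_coprime
      (fun i _ j _ hij => pairwise_coprime_X_sub_C hx.1.injective hij) fun j _ => ?_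
    exact dvd_iff_isRoot.mpr ((hx.2 _).mpr ⟨j, rfl⟩)
  obtain ⟨q, hq⟩ := hdvd
  have hq0 : q ≠ 0 := by rintro rfl; exact hahn_ne_zero n α β N (by simpa using hq)
  have hqd : q.natDegree = 0 := by
    have h1 := congrArg natDegree hq
    have h2 := natDegree_hahn_le n α β N
    rw [natDegree_mul Lagrange.nodal_ne_zero hq0, Lagrange.natDegree_nodal, Finset.card_univ,
      Fintype.card_fin] at h1
    omega
  obtain ⟨c, rfl⟩ := natDegree_eq_zero.mp hqd
  have hc : c ≠ 0 := by simpa using hq0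
  have h := hahn_orthogonal hα hβ hnN hg
  rw [hq, mul_comm _ (C c), mul_assoc, ← smul_eq_C_mul, map_smul, smul_eq_mul] at h
  exact (mul_eq_zero.mp h).resolve_left hc

lemma hahnWeight_ratio_left {α₁ α₂ β : ℝ} (h₁ : -1 < α₁) (h₁₂ : α₁ < α₂) (hβ : -1 < β)
    {N i j : ℕ} (hij : i < j) :
    hahnWeight α₂ β N i * hahnWeight α₁ β N j < hahnWeight α₂ β N j * hahnWeight α₁ β N i := by
  have h := poch_mul_poch_lt (show 0 < α₁ + 1 by linarith)
    (show α₁ + 1 < α₂ + 1 by linarith) hij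
  have hi := poch_pos (show 0 < β + 1 by linarith) (N - i)
  have hj := poch_pos (show 0 < β + 1 by linarith) (N - j)
  have hpos : 0 < poch (β + 1) (N - i) / (N - i).factorial *
      (poch (β + 1) (N - j) / (N - j).factorial) / (i.factorial * j.factorial) := by positivity
  have := mul_lt_mul_of_pos_right h hpos
  unfold hahnWeight
  calc _ = _ := by ring
    _ < _ := this
    _ = _ := by ring

lemma hahnWeight_ratio_right {α β₁ β₂ : ℝ} (hα : -1 < α) (h₁ : -1 < β₁) (h₁₂ : β₁ < β₂)
    {N i j : ℕ} (hij : i < j) (hj : j ≤ N) :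
    hahnWeight α β₁ N i * hahnWeight α β₂ N j < hahnWeight α β₁ N j * hahnWeight α β₂ N i := by
  have h := hahnWeight_ratio_left h₁ h₁₂ hα (N := N) (show N - j < N - i by omega)
  simp only [hahnWeight, show N - (N - i) = i by omega, show N - (N - j) = j by omega] at h ⊢
  calc _ = _ := by ring
    _ < _ := h
    _ = _ := by ring

/-- the Hahn polynomial `Q_n(·;α,β,N)`, `α,β > −1`, `1 ≤ n ≤ N`, has `n` simple
real roots in `(0,N)` with consecutive gaps greater than `1`; the roots are strictly
increasing in `α` and strictly decreasing in `β`. -/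
theorem hahn_roots
    (N : ℕ) (n : ℕ) (hn : 1 ≤ n) (hnN : n ≤ N)
    (α β : ℝ) (hα : -1 < α) (hβ : -1 < β) :
    (∃ x : Fin n → ℝ, IsRootTuple (hahn n α β N) x ∧
      (∀ j, (hahn n α β N).rootMultiplicity (x j) = 1) ∧
      (∀ j, 0 < x j ∧ x j < N) ∧ GapGt 1 x) ∧
    (∀ α₁ α₂ : ℝ, -1 < α₁ → α₁ < α₂ →
      ∀ x₁ x₂ : Fin n → ℝ,
      IsRootTuple (hahn n α₁ β N) x₁ → IsRootTuple (hahn n α₂ β N) x₂ →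
      ∀ j, x₁ j < x₂ j) ∧
    (∀ β₁ β₂ : ℝ, -1 < β₁ → β₁ < β₂ →
      ∀ x₁ x₂ : Fin n → ℝ,
      IsRootTuple (hahn n α β₁ N) x₁ → IsRootTuple (hahn n α β₂ N) x₂ →
      ∀ j, x₂ j < x₁ j) := by
  refine ⟨?_, ?_, ?_⟩
  · obtain ⟨x, hx, hxI, c, hc, hfac⟩ := exists_nodal_eq_of_orthogonal (hn.trans hnN) hnN
      (fun j _ => hahnWeight_pos hα hβ N j) (hahn_ne_zero n α β N) (natDegree_hahn_le n α β N)
      (fun g hg => hahn_orthogonal hα hβ hnN hg)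
    have hroot : IsRootTuple (hahn n α β N) x := by
      refine ⟨hx, fun y => ?_⟩
      rw [hfac, IsRoot, eval_mul, eval_C, Lagrange.eval_nodal]
      simp [hc, Finset.prod_eq_zero_iff, sub_eq_zero]
    refine ⟨x, hroot, fun j => ?_, hxI, hahn_nodes_gap hα hβ hnN hx hxI fun g hg =>
      hahn_orthogonal_nodal_of_isRootTuple hα hβ hnN hroot hg⟩
    refine le_antisymm ?_ ((rootMultiplicity_pos (hahn_ne_zero n α β N)).mpr
      ((hroot.2 _).mpr ⟨j, rfl⟩))
    rw [← count_roots, hfac, roots_C_mul _ hc, Lagrange.nodal_eq,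
      show ∏ i, (X - C (x i)) = ((Finset.univ.val.map x).map fun a => X - C a).prod by
        rw [Multiset.map_map]; rfl,
      roots_multiset_prod_X_sub_C]
    exact Multiset.nodup_iff_count_le_one.mp (Finset.univ.nodup.map hx.injective) _
  · intro α₁ α₂ h₁ h₁₂ x₁ x₂ hx₁ hx₂ j
    have h₂ := h₁.trans h₁₂
    exact zeros_lt_of_weight_ratio hnN (fun j _ => hahnWeight_pos h₁ hβ N j)
      (fun j _ => hahnWeight_pos h₂ hβ N j)
      (fun _ _ hij _ => hahnWeight_ratio_left h₁ h₁₂ hβ hij) hx₁.1 hx₂.1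
      (fun _ hg => hahn_orthogonal_nodal_of_isRootTuple h₁ hβ hnN hx₁ hg)
      (fun _ hg => hahn_orthogonal_nodal_of_isRootTuple h₂ hβ hnN hx₂ hg) j
  · intro β₁ β₂ h₁ h₁₂ x₁ x₂ hx₁ hx₂ j
    have h₂ := h₁.trans h₁₂
    exact zeros_lt_of_weight_ratio hnN (fun j _ => hahnWeight_pos hα h₂ N j)
      (fun j _ => hahnWeight_pos hα h₁ N j)
      (fun _ _ hij hj => hahnWeight_ratio_right hα h₁ h₁₂ hij hj) hx₂.1 hx₁.1
      (fun _ hg => hahn_orthogonal_nodal_of_isRootTuple hα h₂ hnN hx₂ hg)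
      (fun _ hg => hahn_orthogonal_nodal_of_isRootTuple hα h₁ hnN hx₁ hg) j
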